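/- Fix λ ∈ D and θ ∈ (−2,∞), and let ω₁(z) = |(z−λ)/(1−conj(λ)z)|^θ for z ∈ D∖{λ}. Then the function K(z,w) = 1/(1−z·conj(w))² + (θ/2)·(1−|λ|²)/((1−conj(λ)z)(1−λ·conj(w))(1−z·conj(w))) is the reproducing kernel of A²(D,ω₁): for every w ∈ D, K(·,w) ∈ A²(D,ω₁) and ∫_D f(z)·conj(K(z,w))·ω₁(z) dΣ(z) = f(w) for every f ∈ A²(D,ω₁). -/

import Mathlib

open Complex MeasureTheory Metric Set

noncomputable section

/-- The open unit disk in ℂ. -/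
def unitDisk : Set ℂ := Metric.ball 0 1

/-- The closed unit disk in ℂ. -/
def closedDisk : Set ℂ := Metric.closedBall 0 1

/-- The unit circle in ℂ. -/
def unitCircle : Set ℂ := Metric.sphere 0 1

/-- The normalized area measure dΣ = dx dy / π on ℂ. -/
def dSigma : Measure ℂ := (ENNReal.ofReal (1 / Real.pi)) • (volume : Measure ℂ)

/-- The normalized Laplacian Δ = (1/4)(∂²ₓ + ∂²_y) of a real-valued function on ℂ. -/
def lapR (u : ℂ → ℝ) (z : ℂ) : ℝ :=
  (1/4) * (fderiv ℝ (fun w => fderiv ℝ u w 1) z 1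
    + fderiv ℝ (fun w => fderiv ℝ u w Complex.I) z Complex.I)

/-- The normalized Laplacian Δ = (1/4)(∂²ₓ + ∂²_y) of a complex-valued function on ℂ. -/
def lapC (u : ℂ → ℂ) (z : ℂ) : ℂ :=
  (1/4) * (fderiv ℝ (fun w => fderiv ℝ u w 1) z 1
    + fderiv ℝ (fun w => fderiv ℝ u w Complex.I) z Complex.I)

/-- Membership in the weighted Bergman space A²(𝔻, ω): holomorphic on the unit disk
and square integrable against the weight ω with respect to dΣ. -/
def MemA2 (ω : ℂ → ℝ) (f : ℂ → ℂ) : Prop :=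
  DifferentiableOn ℂ f unitDisk ∧
    IntegrableOn (fun z => ‖f z‖ ^ 2 * ω z) unitDisk dSigma

/-- `k` reproduces at `w` for the weight `ω`. -/
def Reproduces (ω : ℂ → ℝ) (k : ℂ → ℂ) (w : ℂ) : Prop :=
  MemA2 ω k ∧ ∀ f : ℂ → ℂ, MemA2 ω f →
    ∫ z in unitDisk, f z * (starRingEnd ℂ) (k z) * (ω z : ℂ) ∂dSigma = f w

/-- A bounded (complex-valued) harmonic function on the unit disk. -/
def BoundedHarmonicC (h : ℂ → ℂ) : Prop :=
  ContDiffOn ℝ 2 h unitDisk ∧ (∀ z ∈ unitDisk, lapC h z = 0) ∧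
    ∃ M : ℝ, ∀ z ∈ unitDisk, ‖h z‖ ≤ M

/-- A bounded real-valued harmonic function on the unit disk. -/
def BoundedHarmonicR (h : ℂ → ℝ) : Prop :=
  ContDiffOn ℝ 2 h unitDisk ∧ (∀ z ∈ unitDisk, lapR h z = 0) ∧
    ∃ M : ℝ, ∀ z ∈ unitDisk, |h z| ≤ M

/-- The kernel for `lam = 0`. -/
def K0 (θ : ℝ) (z w : ℂ) : ℂ :=
  1 / (1 - z * (starRingEnd ℂ) w) ^ 2 + ((θ / 2 : ℝ) : ℂ) / (1 - z * (starRingEnd ℂ) w)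

lemma one_sub_ne {z w : ℂ} (hz : ‖z‖ ≤ 1) (hw : ‖w‖ < 1) : 1 - z * w ≠ 0 := by
  intro h
  have h1 : z * w = 1 := (sub_eq_zero.mp h).symm
  have h2 : ‖z‖ * ‖w‖ = 1 := by rw [← norm_mul, h1, norm_one]
  nlinarith [norm_nonneg z, norm_nonneg w]

lemma angular (f : ℂ → ℂ) (hf : DifferentiableOn ℂ f (ball 0 1)) (w : ℂ) (hw : ‖w‖ < 1)
    (θ r : ℝ) (hr : 0 < r) (hr1 : r < 1) :
    ∫ t in (0 : ℝ)..(2 * Real.pi), f (circleMap 0 r t) * (starRingEnd ℂ) (K0 θ (circleMap 0 r t) w)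
      = 2 * Real.pi * ((r : ℂ) ^ 2 * w * deriv f ((r : ℂ) ^ 2 * w)
        + (1 + θ / 2) * f ((r : ℂ) ^ 2 * w)) := by
  set u : ℂ := (r : ℂ) ^ 2 * w with hu
  have hub : u ∈ ball (0 : ℂ) r := by
    simp only [mem_ball, dist_zero_right, hu, norm_mul, norm_pow, Complex.norm_real,
      Real.norm_eq_abs, abs_of_pos hr]
    nlinarith [norm_nonneg w, mul_lt_mul_of_pos_left hw (mul_pos hr hr)]
  have hsub : closedBall (0 : ℂ) r ⊆ ball 0 1 := closedBall_subset_ball hr1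
  have hu1 : u ∈ ball (0 : ℂ) 1 := hsub (ball_subset_closedBall hub)
  have hfd : DifferentiableAt ℂ f u := hf.differentiableAt (isOpen_ball.mem_nhds hu1)
  have hg : DifferentiableOn ℂ (fun z => z * f z) (ball 0 1) := differentiableOn_id.mul hf
  have h2pi : (2 * Real.pi * I : ℂ) ≠ 0 := Complex.two_pi_I_ne_zero
  have e1 : (∮ z in C(0, r), ((z - u) ^ 2)⁻¹ • (z * f z)) = 2 * Real.pi * I * (f u + u * deriv f u) := by
    have := two_pi_I_inv_smul_circleIntegral_sub_sq_inv_smul_of_differentiable isOpen_ball hsub hg hub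
    have hd : deriv (fun z => z * f z) u = f u + u * deriv f u := by
      have := (hasDerivAt_id u).mul hfd.hasDerivAt
      have h := this.deriv
      simp only [id, one_mul] at h
      exact h
    rw [hd, smul_eq_mul] at this
    rw [← this, ← mul_assoc, mul_inv_cancel₀ h2pi, one_mul]
  have e2 : (∮ z in C(0, r), (z - u)⁻¹ • f z) = 2 * Real.pi * I * f u := by
    have := (hf.diffContOnCl_ball hsub).circleIntegral_sub_inv_smul hub
    simpa using this
  have hne : ∀ z ∈ sphere (0 : ℂ) r, z - u ≠ 0 := by
    intro z hz h
    exact sphere_disjoint_ball.ne_of_mem hz hub (sub_eq_zero.mp h)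
  have hfc : ContinuousOn f (sphere 0 r) :=
    hf.continuousOn.mono (sphere_subset_closedBall.trans hsub)
  have i1 : CircleIntegrable (fun z => ((z - u) ^ 2)⁻¹ • (z * f z)) 0 r := by
    apply ContinuousOn.circleIntegrable hr.le
    refine ContinuousOn.mul (f := fun z => ((z - u) ^ 2)⁻¹) (g := fun z => z * f z) ?_ ?_
    · exact ContinuousOn.inv₀ (by fun_prop) (fun z hz => pow_ne_zero _ (hne z hz))
    · exact continuousOn_id.mul hfc
  have i2 : CircleIntegrable (fun z => (((θ / 2 : ℝ)) : ℂ) • ((z - u)⁻¹ • f z)) 0 r := by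
    apply ContinuousOn.circleIntegrable hr.le
    refine ContinuousOn.mul (f := fun z => (((θ / 2 : ℝ)) : ℂ)) (g := fun z => (z - u)⁻¹ * f z)
      continuousOn_const ?_
    exact ContinuousOn.mul (ContinuousOn.inv₀ (by fun_prop) hne) hfc
  have e3 := circleIntegral.integral_add i1 i2
  rw [circleIntegral.integral_smul, e1, e2] at e3
  simp only [circleIntegral] at e3
  have key : ∀ t : ℝ, f (circleMap 0 r t) * (starRingEnd ℂ) (K0 θ (circleMap 0 r t) w) =
      I⁻¹ * (deriv (circleMap 0 r) t • (((circleMap 0 r t - u) ^ 2)⁻¹ • (circleMap 0 r t * f (circleMap 0 r t)) + (((θ / 2 : ℝ)) : ℂ) • ((circleMap 0 r t - u)⁻¹ • f (circleMap 0 r t)))) := by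
    intro t
    have hz : circleMap 0 r t ∈ sphere (0 : ℂ) r := circleMap_mem_sphere 0 hr.le t
    rw [deriv_circleMap]
    simp only [K0]
    generalize circleMap 0 r t = z at hz
    have hzu := hne z hz
    have hz0 : z ≠ 0 := by
      rintro rfl
      simp at hz; exact hr.ne hz
    have hzz : z * (starRingEnd ℂ) z = (r : ℂ) ^ 2 := by
      rw [Complex.mul_conj, Complex.normSq_eq_norm_sq]
      simp at hz; rw [hz]; push_cast; rfl
    have hd : 1 - (starRingEnd ℂ) z * w = (z - u) / z := by
      rw [hu, ← hzz]; field_simp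
    simp only [map_add, map_div₀, map_one, map_pow, map_sub, map_mul, Complex.conj_conj,
      Complex.conj_ofReal, hd, smul_eq_mul, sub_zero]
    field_simp
  simp_rw [key]
  rw [intervalIntegral.integral_const_mul, e3]
  rw [smul_eq_mul]
  field_simp
  push_cast
  ring

lemma radial (f : ℂ → ℂ) (hf : DifferentiableOn ℂ f (ball 0 1)) (w : ℂ) (hw : ‖w‖ < 1)
    (θ : ℝ) (hθ : -2 < θ) :
    ∫ r in (0 : ℝ)..1, ((r ^ (θ + 1) : ℝ) : ℂ) * (2 * ((r : ℂ) ^ 2 * w * deriv f ((r : ℂ) ^ 2 * w)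
        + (1 + θ / 2) * f ((r : ℂ) ^ 2 * w))) = f w := by
  have hm : ∀ r ∈ Icc (0:ℝ) 1, (r : ℂ) ^ 2 * w ∈ ball (0 : ℂ) 1 := by
    intro r hr
    simp only [mem_ball, dist_zero_right, norm_mul, norm_pow, Complex.norm_real,
      Real.norm_eq_abs, abs_of_nonneg hr.1]
    have : r ^ 2 ≤ 1 := by nlinarith [hr.1, hr.2]
    nlinarith [norm_nonneg w]
  have hc : ContinuousOn (fun r : ℝ => (r : ℂ) ^ 2 * w) (Icc 0 1) := by fun_prop
  have hfc : ContinuousOn (fun r : ℝ => f ((r : ℂ) ^ 2 * w)) (Icc 0 1) :=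
    hf.continuousOn.comp hc hm
  have hdc : ContinuousOn (fun r : ℝ => deriv f ((r : ℂ) ^ 2 * w)) (Icc 0 1) :=
    (hf.deriv isOpen_ball).continuousOn.comp hc hm
  have := intervalIntegral.integral_eq_sub_of_hasDerivAt_of_le (a := 0) (b := 1) zero_le_one
    (f := fun r : ℝ => ((r ^ (θ + 2) : ℝ) : ℂ) * f ((r : ℂ) ^ 2 * w))
    (f' := fun r : ℝ => ((r ^ (θ + 1) : ℝ) : ℂ) * (2 * ((r : ℂ) ^ 2 * w * deriv f ((r : ℂ) ^ 2 * w)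
        + (1 + θ / 2) * f ((r : ℂ) ^ 2 * w)))) ?_ ?_ ?_
  · rw [this]
    simp [Real.zero_rpow (by linarith : θ + 2 ≠ 0)]
  · apply ContinuousOn.mul _ hfc
    apply Continuous.continuousOn
    exact Complex.continuous_ofReal.comp (Real.continuous_rpow_const (by linarith))
  · intro r hr
    have h1 : HasDerivAt (fun r : ℝ => r ^ (θ + 2)) ((θ + 2) * r ^ (θ + 2 - 1)) r :=
      Real.hasDerivAt_rpow_const (Or.inl hr.1.ne')
    have h2 : HasDerivAt (fun r : ℝ => (r : ℂ) ^ 2 * w) (2 * r * w) r := by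
      have := ((hasDerivAt_id r).ofReal_comp.pow 2).mul_const w
      simpa using this
    have h3 : HasDerivAt f (deriv f ((r : ℂ) ^ 2 * w)) ((r : ℂ) ^ 2 * w) :=
      (hf.differentiableAt (isOpen_ball.mem_nhds (hm r ⟨hr.1.le, hr.2.le⟩))).hasDerivAt
    have h4 := h3.comp r h2
    have h5 := h1.ofReal_comp.mul h4
    refine h5.congr_deriv ?_
    have e1 : r ^ (θ + 2 - 1) = r ^ (θ + 1) := by ring_nf
    have e2 : r ^ (θ + 2) = r ^ (θ + 1) * r := by
      rw [← Real.rpow_add_one hr.1.ne']; ring_nf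
    simp only [e1, e2, Function.comp]
    push_cast
    ring
  · apply IntervalIntegrable.mul_continuousOn
    · have h0 : IntervalIntegrable (fun r : ℝ => r ^ (θ + 1)) volume 0 1 :=
        intervalIntegral.intervalIntegrable_rpow' (by linarith)
      rw [intervalIntegrable_iff] at h0 ⊢
      exact h0.ofReal
    · rw [uIcc_of_le zero_le_one]
      exact continuousOn_const.mul ((hc.mul hdc).add (continuousOn_const.mul hfc))

lemma integrable_rpow (θ : ℝ) (hθ : -2 < θ) :
    IntegrableOn (fun z : ℂ => ‖z‖ ^ θ) (ball 0 1) := by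
  have h := integrable_fun_norm_addHaar (volume : Measure ℂ)
    (f := (Iio (1:ℝ)).indicator fun r => r ^ θ)
  rw [← integrable_indicator_iff measurableSet_ball]
  have e : (ball (0:ℂ) 1).indicator (fun z : ℂ => ‖z‖ ^ θ) =
      fun z => (Iio (1:ℝ)).indicator (fun r => r ^ θ) ‖z‖ := by
    ext z; simp [indicator]
  rw [e, h]
  simp only [Complex.finrank_real_complex]
  have e2 : IntegrableOn (fun y : ℝ => y ^ (θ + 1)) (Ioo 0 1) := by
    have := intervalIntegral.intervalIntegrable_rpow' (a := 0) (b := 1) (r := θ + 1) (by linarith)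
    rw [intervalIntegrable_iff_integrableOn_Ioo_of_le zero_le_one] at this
    exact this
  have e3 : IntegrableOn ((Iio (1:ℝ)).indicator (fun y : ℝ => y ^ (θ + 1))) (Ioi 0) := by
    rw [integrableOn_indicator_iff measurableSet_Iio, inter_comm]
    exact e2
  refine e3.congr_fun (fun y hy => ?_) measurableSet_Ioi
  simp only [indicator]
  split_ifs
  · simp [Real.rpow_add_one (ne_of_gt hy), mul_comm]
  · simp

lemma one_sub_conj_ne {z w : ℂ} (hz : ‖z‖ ≤ 1) (hw : ‖w‖ < 1) :
    1 - z * (starRingEnd ℂ) w ≠ 0 :=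
  one_sub_ne hz (by simpa using hw)

lemma K0_cont (θ : ℝ) (w : ℂ) (hw : ‖w‖ < 1) :
    ContinuousOn (fun z => K0 θ z w) (closedBall 0 1) := by
  have h : ∀ z ∈ closedBall (0:ℂ) 1, 1 - z * (starRingEnd ℂ) w ≠ 0 := fun z hz =>
    one_sub_conj_ne (by simpa using hz) hw
  unfold K0
  exact ContinuousOn.add
    (ContinuousOn.div continuousOn_const (by fun_prop) fun z hz => pow_ne_zero _ (h z hz))
    (ContinuousOn.div continuousOn_const (by fun_prop) h)

lemma K0_diff (θ : ℝ) (w : ℂ) (hw : ‖w‖ < 1) :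
    DifferentiableOn ℂ (fun z => K0 θ z w) (ball 0 1) := by
  have h : ∀ z ∈ ball (0:ℂ) 1, 1 - z * (starRingEnd ℂ) w ≠ 0 := fun z hz =>
    one_sub_conj_ne (by simpa using (mem_ball.mp hz).le) hw
  unfold K0
  exact DifferentiableOn.add
    (DifferentiableOn.div (differentiableOn_const _) (by fun_prop) fun z hz => pow_ne_zero _ (h z hz))
    (DifferentiableOn.div (differentiableOn_const _) (by fun_prop) h)

lemma K0_bound (θ : ℝ) (w : ℂ) (hw : ‖w‖ < 1) :
    ∃ M : ℝ, ∀ z ∈ ball (0:ℂ) 1, ‖K0 θ z w‖ ≤ M := by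
  obtain ⟨M, hM⟩ := (isCompact_closedBall (0:ℂ) 1).exists_bound_of_continuousOn (K0_cont θ w hw)
  exact ⟨M, fun z hz => hM z (ball_subset_closedBall hz)⟩

lemma meas_ind {g : ℂ → ℂ} (hg : ContinuousOn g (ball 0 1)) :
    Measurable ((ball (0:ℂ) 1).indicator g) := by
  classical
  rw [← piecewise_eq_indicator]
  exact hg.measurable_piecewise continuousOn_const measurableSet_ball

lemma K0_integrable (θ : ℝ) (hθ : -2 < θ) (w : ℂ) (hw : ‖w‖ < 1) :
    IntegrableOn (fun z => ‖K0 θ z w‖ ^ 2 * ‖z‖ ^ θ) (ball 0 1) := by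
  obtain ⟨M, hM⟩ := K0_bound θ w hw
  refine Integrable.bdd_mul (c := M ^ 2) (integrable_rpow θ hθ) ?_ ?_
  · exact (((K0_diff θ w hw).continuousOn.norm).pow 2).aestronglyMeasurable measurableSet_ball
  · refine (ae_restrict_iff' measurableSet_ball).mpr (Filter.Eventually.of_forall fun z hz => ?_)
    rw [norm_pow, norm_norm]
    exact pow_le_pow_left₀ (norm_nonneg _) (hM z hz) 2

lemma disk0 (f : ℂ → ℂ) (hf : DifferentiableOn ℂ f (ball 0 1)) (w : ℂ) (hw : ‖w‖ < 1)
    (θ : ℝ) (hθ : -2 < θ) (hi : IntegrableOn (fun z => ‖f z‖ ^ 2 * ‖z‖ ^ θ) (ball 0 1)) :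
    ∫ z in ball (0:ℂ) 1, f z * (starRingEnd ℂ) (K0 θ z w) * ((‖z‖ ^ θ : ℝ) : ℂ)
      = Real.pi * f w := by
  obtain ⟨M, hM⟩ := K0_bound θ w hw
  set G : ℂ → ℂ := fun z => f z * (starRingEnd ℂ) (K0 θ z w) with hG
  have hGc : ContinuousOn G (ball 0 1) :=
    hf.continuousOn.mul (Complex.continuous_conj.comp_continuousOn (K0_diff θ w hw).continuousOn)
  set F : ℂ → ℂ := fun z => (ball (0:ℂ) 1).indicator G z * ((‖z‖ ^ θ : ℝ) : ℂ) with hF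
  have hFm : Measurable F := (meas_ind hGc).mul (by fun_prop)
  have hFe : F = (ball (0:ℂ) 1).indicator (fun z => G z * ((‖z‖ ^ θ : ℝ) : ℂ)) := by
    ext z; simp only [hF, indicator]; split_ifs <;> simp
  have hFi : Integrable F := by
    rw [hFe, integrable_indicator_iff measurableSet_ball]
    refine Integrable.mono' (((integrable_rpow θ hθ).add hi).const_mul M) ?_ ?_
    · have := hFm.aestronglyMeasurable (μ := volume.restrict (ball (0:ℂ) 1))
      rw [hFe] at this
      refine this.congr ?_
      exact indicator_ae_eq_restrict measurableSet_ball
    · refine (ae_restrict_iff' measurableSet_ball).mpr (Filter.Eventually.of_forall fun z hz => ?_)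
      have h0 : 0 ≤ ‖z‖ ^ θ := Real.rpow_nonneg (norm_nonneg _) _
      have h1 := hM z hz
      simp only [hG, norm_mul, RCLike.norm_conj, Complex.norm_real, Real.norm_eq_abs,
        abs_of_nonneg h0, Pi.add_apply]
      have h2 : ‖f z‖ ≤ 1 + ‖f z‖ ^ 2 := by nlinarith [sq_nonneg (‖f z‖ - 1), norm_nonneg (f z)]
      have h3 : ‖f z‖ * ‖K0 θ z w‖ ≤ (1 + ‖f z‖ ^ 2) * M :=
        mul_le_mul h2 h1 (norm_nonneg _) (by positivity)
      calc _ ≤ (1 + ‖f z‖ ^ 2) * M * ‖z‖ ^ θ := mul_le_mul_of_nonneg_right h3 h0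
        _ = _ := by ring
  have hpi : IntegrableOn (fun p : ℝ × ℝ => p.1 • F (Complex.polarCoord.symm p))
      polarCoord.target := by
    refine ⟨?_, ?_⟩
    · apply Measurable.aestronglyMeasurable
      apply measurable_fst.smul
      apply hFm.comp
      have : (fun p : ℝ × ℝ => Complex.polarCoord.symm p) =
        fun p => (p.1 * (Real.cos p.2 + Real.sin p.2 * Complex.I) : ℂ) := by
        ext p; exact Complex.polarCoord_symm_apply p
      change Measurable (fun p : ℝ × ℝ => Complex.polarCoord.symm p)
      rw [this]
      fun_prop
    · have h := Complex.lintegral_comp_polarCoord_symm (fun z => ‖F z‖ₑ)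
      have h' := hFi.2
      rw [HasFiniteIntegral, ← h] at h'
      rw [HasFiniteIntegral]
      refine lt_of_le_of_lt (le_of_eq ?_) h'
      refine setLIntegral_congr_fun polarCoord.open_target.measurableSet fun p hp => ?_
      have hp1 : 0 < p.1 := by
        rw [polarCoord_target] at hp; exact hp.1
      simp only [enorm_smul, smul_eq_mul, Real.enorm_eq_ofReal hp1.le]
  have hE : ∫ z in ball (0:ℂ) 1, f z * (starRingEnd ℂ) (K0 θ z w) * ((‖z‖ ^ θ : ℝ) : ℂ)
      = ∫ z, F z := by
    rw [hFe, integral_indicator measurableSet_ball]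
  rw [hE, ← Complex.integral_comp_polarCoord_symm]
  rw [polarCoord_target] at hpi ⊢
  rw [Measure.volume_eq_prod] at hpi ⊢
  rw [setIntegral_prod _ hpi]
  have inner : ∀ r ∈ Ioi (0:ℝ), ∫ t in Ioo (-Real.pi) Real.pi,
      r • F (Complex.polarCoord.symm (r, t)) = (Ioo (0:ℝ) 1).indicator
      (fun r => Real.pi * (((r ^ (θ + 1) : ℝ) : ℂ) * (2 * ((r : ℂ) ^ 2 * w * deriv f ((r : ℂ) ^ 2 * w)
        + (1 + θ / 2) * f ((r : ℂ) ^ 2 * w))))) r := by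
    intro r hr
    have hr : 0 < r := hr
    have hcm : ∀ t : ℝ, Complex.polarCoord.symm (r, t) = circleMap 0 r t := by
      intro t
      rw [Complex.polarCoord_symm_apply, circleMap, Complex.exp_mul_I]
      simp
    have hn : ∀ t : ℝ, ‖circleMap 0 r t‖ = r := by
      intro t; simp [abs_of_pos hr]
    simp_rw [hcm]
    by_cases hr1 : r < 1
    · rw [indicator_of_mem (show r ∈ Ioo (0:ℝ) 1 from ⟨hr, hr1⟩)]
      have hval : ∀ t : ℝ, r • F (circleMap 0 r t) = ((r ^ (θ + 1) : ℝ) : ℂ) *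
          (f (circleMap 0 r t) * (starRingEnd ℂ) (K0 θ (circleMap 0 r t) w)) := by
        intro t
        have hmem : circleMap 0 r t ∈ ball (0:ℂ) 1 := by
          rw [mem_ball_zero_iff, hn]; exact hr1
        simp only [hF, indicator_of_mem hmem, hn, hG, Real.rpow_add_one hr.ne']
        rw [Complex.real_smul]; push_cast; ring
      simp_rw [hval]
      rw [integral_const_mul, ← integral_Ioc_eq_integral_Ioo,
        ← intervalIntegral.integral_of_le (by linarith [Real.pi_pos])]
      have hper : Function.Periodic (fun t : ℝ => f (circleMap 0 r t) *
          (starRingEnd ℂ) (K0 θ (circleMap 0 r t) w)) (2 * Real.pi) := by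
        intro t
        simp only [periodic_circleMap 0 r t]
      have hs := hper.intervalIntegral_add_eq (-Real.pi) 0
      rw [show -Real.pi + 2 * Real.pi = Real.pi by ring, zero_add] at hs
      rw [hs, angular f hf w hw θ r hr hr1]
      ring
    · rw [indicator_of_notMem (fun h => hr1 h.2)]
      have hval : ∀ t : ℝ, F (circleMap 0 r t) = 0 := by
        intro t
        have hmem : circleMap 0 r t ∉ ball (0:ℂ) 1 := by
          rw [mem_ball_zero_iff, hn]; exact hr1
        simp [hF, indicator_of_notMem hmem]
      simp [hval]
  rw [setIntegral_congr_fun measurableSet_Ioi inner, setIntegral_indicator measurableSet_Ioo,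
    inter_eq_self_of_subset_right (fun x hx => hx.1), integral_const_mul,
    ← integral_Ioc_eq_integral_Ioo, ← intervalIntegral.integral_of_le zero_le_one,
    radial f hf w hw θ hθ]

/-- Disk involution. -/
def mob (a z : ℂ) : ℂ := (a - z) / (1 - (starRingEnd ℂ) a * z)

/-- Derivative of the disk involution. -/
def dmob (a z : ℂ) : ℂ := -(1 - (starRingEnd ℂ) a * a) / (1 - (starRingEnd ℂ) a * z) ^ 2

lemma den_ne {a z : ℂ} (ha : ‖a‖ < 1) (hz : ‖z‖ < 1) : 1 - (starRingEnd ℂ) a * z ≠ 0 :=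
  one_sub_ne (by simpa using ha.le) hz

lemma den_mob {a z : ℂ} (ha : ‖a‖ < 1) (hz : ‖z‖ < 1) :
    1 - (starRingEnd ℂ) a * mob a z
      = (1 - (starRingEnd ℂ) a * a) / (1 - (starRingEnd ℂ) a * z) := by
  have := den_ne ha hz
  unfold mob
  field_simp
  ring

lemma mob_mob {a z : ℂ} (ha : ‖a‖ < 1) (hz : ‖z‖ < 1) : mob a (mob a z) = z := by
  have h := den_ne ha hz
  have h1 := den_ne ha ha
  have h2 := den_mob ha hz
  rw [mob, h2, mob]
  have h1' : 1 - a * (starRingEnd ℂ) a ≠ 0 := by rwa [mul_comm]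
  have h' : 1 - z * (starRingEnd ℂ) a ≠ 0 := by rwa [mul_comm]
  field_simp
  ring

lemma dmob_mob {a z : ℂ} (ha : ‖a‖ < 1) (hz : ‖z‖ < 1) : dmob a (mob a z) * dmob a z = 1 := by
  have h := den_ne ha hz
  have h1 := den_ne ha ha
  rw [dmob, den_mob ha hz, dmob]
  field_simp

lemma one_sub_mob {a z w : ℂ} (ha : ‖a‖ < 1) (hz : ‖z‖ < 1) (hw : ‖w‖ < 1) :
    1 - mob a z * (starRingEnd ℂ) (mob a w) =
      (1 - (starRingEnd ℂ) a * a) * (1 - z * (starRingEnd ℂ) w) /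
        ((1 - (starRingEnd ℂ) a * z) * (1 - a * (starRingEnd ℂ) w)) := by
  have h := den_ne ha hz
  have h1 : 1 - a * (starRingEnd ℂ) w ≠ 0 := one_sub_conj_ne ha.le hw
  simp only [mob, map_div₀, map_sub, map_mul, map_one, Complex.conj_conj]
  have h' : 1 - z * (starRingEnd ℂ) a ≠ 0 := by rwa [mul_comm]
  have h1' : 1 - (starRingEnd ℂ) w * a ≠ 0 := by rwa [mul_comm]
  field_simp
  ring

lemma mob_mem {a z : ℂ} (ha : ‖a‖ < 1) (hz : ‖z‖ < 1) : ‖mob a z‖ < 1 := by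
  have h := den_ne ha hz
  rw [mob, norm_div, div_lt_one (norm_pos_iff.mpr h)]
  apply lt_of_pow_lt_pow_left₀ 2 (norm_nonneg _)
  have ha2 : ‖a‖ ^ 2 < 1 := by nlinarith [norm_nonneg a]
  have hz2 : ‖z‖ ^ 2 < 1 := by nlinarith [norm_nonneg z]
  rw [← Complex.normSq_eq_norm_sq, Complex.normSq_apply] at *
  rw [← Complex.normSq_eq_norm_sq, Complex.normSq_apply] at *
  simp only [Complex.sub_re, Complex.sub_im, Complex.mul_re, Complex.mul_im, Complex.conj_re,
    Complex.conj_im, Complex.one_re, Complex.one_im]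
  nlinarith [mul_pos (sub_pos.mpr ha2) (sub_pos.mpr hz2)]

lemma mob_deriv {a z : ℂ} (ha : ‖a‖ < 1) (hz : ‖z‖ < 1) : HasDerivAt (mob a) (dmob a z) z := by
  have h := den_ne ha hz
  have h1 : HasDerivAt (fun z => a - z) (-1) z := by
    simpa using (hasDerivAt_id z).const_sub a
  have h2 : HasDerivAt (fun z => 1 - (starRingEnd ℂ) a * z) (-(starRingEnd ℂ) a) z := by
    simpa using ((hasDerivAt_id z).const_mul ((starRingEnd ℂ) a)).const_sub 1
  refine (h1.div h2 h).congr_deriv ?_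
  rw [dmob]
  congr 1
  ring

lemma mob_image {a : ℂ} (ha : ‖a‖ < 1) : mob a '' ball 0 1 = ball 0 1 := by
  ext z
  simp only [mem_image, mem_ball_zero_iff]
  constructor
  · rintro ⟨y, hy, rfl⟩
    exact mob_mem ha hy
  · intro hz
    exact ⟨mob a z, mob_mem ha hz, mob_mob ha hz⟩

lemma mob_inj {a : ℂ} (ha : ‖a‖ < 1) : InjOn (mob a) (ball 0 1) := by
  intro x hx y hy h
  rw [← mob_mob ha (mem_ball_zero_iff.mp hx), h, mob_mob ha (mem_ball_zero_iff.mp hy)]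

/-- the real derivative of `mob` -/
def rmob (a z : ℂ) : ℂ →L[ℝ] ℂ :=
  (ContinuousLinearMap.toSpanSingleton ℂ (dmob a z)).restrictScalars ℝ

lemma rmob_det (a z : ℂ) : |(rmob a z).det| = ‖dmob a z‖ ^ 2 := by
  have : (rmob a z).det = ‖dmob a z‖ ^ 2 := by
    rw [rmob, ContinuousLinearMap.det]
    have := LinearMap.det_restrictScalars (R := ℝ) (S := ℂ) (A := ℂ)
      (f := (ContinuousLinearMap.toSpanSingleton ℂ (dmob a z) : ℂ →ₗ[ℂ] ℂ))
    refine Eq.trans this ?_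
    rw [Algebra.norm_complex_eq]
    simp [Complex.normSq_eq_norm_sq]
  rw [this, abs_of_nonneg (by positivity)]

lemma rmob_fderiv {a : ℂ} (ha : ‖a‖ < 1) : ∀ z ∈ ball (0:ℂ) 1,
    HasFDerivWithinAt (mob a) (rmob a z) (ball 0 1) z := fun z hz =>
  ((mob_deriv ha (mem_ball_zero_iff.mp hz)).hasFDerivAt.restrictScalars ℝ).hasFDerivWithinAt

lemma cov_integral {a : ℂ} (ha : ‖a‖ < 1) (g : ℂ → ℂ) :
    ∫ z in ball (0:ℂ) 1, g z = ∫ z in ball (0:ℂ) 1, (‖dmob a z‖ ^ 2) • g (mob a z) := by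
  have := integral_image_eq_integral_abs_det_fderiv_smul volume measurableSet_ball
    (rmob_fderiv ha) (mob_inj ha) g
  rw [mob_image ha] at this
  simpa only [rmob_det] using this

lemma cov_integrable {a : ℂ} (ha : ‖a‖ < 1) (g : ℂ → ℝ) :
    IntegrableOn g (ball 0 1) ↔
      IntegrableOn (fun z => (‖dmob a z‖ ^ 2) • g (mob a z)) (ball 0 1) := by
  have := integrableOn_image_iff_integrableOn_abs_det_fderiv_smul volume measurableSet_ball
    (rmob_fderiv ha) (mob_inj ha) g
  rw [mob_image ha] at this
  simpa only [rmob_det] using this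

lemma dmob_diff {a : ℂ} (ha : ‖a‖ < 1) : DifferentiableOn ℂ (dmob a) (ball 0 1) := by
  unfold dmob
  exact DifferentiableOn.div (differentiableOn_const _) (by fun_prop)
    fun z hz => pow_ne_zero _ (den_ne ha (mem_ball_zero_iff.mp hz))

lemma mob_diff {a : ℂ} (ha : ‖a‖ < 1) : DifferentiableOn ℂ (mob a) (ball 0 1) :=
  fun _ hz => (mob_deriv ha (mem_ball_zero_iff.mp hz)).differentiableAt.differentiableWithinAt

lemma K_eq {a z w : ℂ} (ha : ‖a‖ < 1) (hz : ‖z‖ < 1) (hw : ‖w‖ < 1) (θ : ℝ) :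
    1 / (1 - z * (starRingEnd ℂ) w) ^ 2 +
        ((θ / 2 : ℝ) : ℂ) * (((1 - ‖a‖ ^ 2 : ℝ)) : ℂ) /
          ((1 - (starRingEnd ℂ) a * z) * (1 - a * (starRingEnd ℂ) w) *
            (1 - z * (starRingEnd ℂ) w)) =
      dmob a z * (starRingEnd ℂ) (dmob a w) * K0 θ (mob a z) (mob a w) := by
  have h1 := den_ne ha hz
  have h2 := den_ne ha ha
  have h3 : 1 - a * (starRingEnd ℂ) w ≠ 0 := one_sub_conj_ne ha.le hw
  have h4 : 1 - z * (starRingEnd ℂ) w ≠ 0 := one_sub_conj_ne hz.le hw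
  have h5 : (((1 - ‖a‖ ^ 2 : ℝ)) : ℂ) = 1 - (starRingEnd ℂ) a * a := by
    rw [mul_comm, Complex.mul_conj, Complex.normSq_eq_norm_sq]; push_cast; rfl
  have h6 : (starRingEnd ℂ) (dmob a w) =
      -(1 - (starRingEnd ℂ) a * a) / (1 - a * (starRingEnd ℂ) w) ^ 2 := by
    simp only [dmob, map_div₀, map_neg, map_sub, map_mul, map_one, map_pow, Complex.conj_conj]
    rw [mul_comm a]
  rw [h5, h6, K0, one_sub_mob ha hz hw, dmob]
  generalize (1 - (starRingEnd ℂ) a * a) = s at *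
  have h' : 1 - z * (starRingEnd ℂ) a ≠ 0 := by rwa [mul_comm]
  have h3' : 1 - (starRingEnd ℂ) w * a ≠ 0 := by rwa [mul_comm]
  field_simp

lemma dSig_c : ENNReal.ofReal (1 / Real.pi) ≠ 0 := by
  simp [Real.pi_pos]

lemma intOn_dSigma {g : ℂ → ℝ} :
    IntegrableOn g unitDisk dSigma ↔ IntegrableOn g (ball 0 1) := by
  unfold IntegrableOn dSigma unitDisk
  rw [Measure.restrict_smul]
  exact integrable_smul_measure dSig_c ENNReal.ofReal_ne_top

lemma int_dSigma (g : ℂ → ℂ) :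
    ∫ z in unitDisk, g z ∂dSigma = ((1 / Real.pi : ℝ) : ℂ) * ∫ z in ball (0:ℂ) 1, g z := by
  unfold dSigma unitDisk
  rw [Measure.restrict_smul, integral_smul_measure,
    ENNReal.toReal_ofReal (by positivity), Complex.real_smul]

/-- explicit reproducing kernel for the weight
ω₁(z) = |(z-λ)/(1-conj(λ)z)|^θ, -2 < θ < ∞. -/
theorem statement12 (lam : ℂ) (hlam : lam ∈ unitDisk) (θ : ℝ) (hθ : -2 < θ)
    (ω₁ : ℂ → ℝ) (K : ℂ → ℂ → ℂ)
    (hω₁ : ∀ z : ℂ, ω₁ z = ‖(z - lam) / (1 - (starRingEnd ℂ) lam * z)‖ ^ θ)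
    (hK : ∀ z w : ℂ, K z w =
      1 / (1 - z * (starRingEnd ℂ) w) ^ 2 +
        ((θ / 2 : ℝ) : ℂ) * (((1 - ‖lam‖ ^ 2 : ℝ)) : ℂ) /
          ((1 - (starRingEnd ℂ) lam * z) * (1 - lam * (starRingEnd ℂ) w) *
            (1 - z * (starRingEnd ℂ) w))) :
    ∀ w ∈ unitDisk, Reproduces ω₁ (fun z => K z w) w := by

  intro w hw
  have ha : ‖lam‖ < 1 := mem_ball_zero_iff.mp hlam
  have hw : ‖w‖ < 1 := mem_ball_zero_iff.mp hw
  have hω : ω₁ = fun z => ‖mob lam z‖ ^ θ := by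
    ext z
    rw [hω₁, mob, norm_div, norm_div, norm_sub_rev]
  have hmw := mob_mem ha hw
  have hKe : ∀ z ∈ ball (0:ℂ) 1, K z w =
      dmob lam z * (starRingEnd ℂ) (dmob lam w) * K0 θ (mob lam z) (mob lam w) := fun z hz => by
    rw [hK, K_eq ha (mem_ball_zero_iff.mp hz) hw θ]
  have hmaps : MapsTo (mob lam) (ball 0 1) (ball 0 1) := fun z hz =>
    mem_ball_zero_iff.mpr (mob_mem ha (mem_ball_zero_iff.mp hz))
  subst hω
  refine ⟨⟨?_, ?_⟩, ?_⟩
  · refine DifferentiableOn.congr ?_ hKe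
    exact ((dmob_diff ha).mul (differentiableOn_const _)).mul
      ((K0_diff θ _ hmw).comp (mob_diff ha) hmaps)
  · rw [intOn_dSigma]
    have h := (cov_integrable ha _).mp (K0_integrable θ hθ _ hmw)
    refine IntegrableOn.congr_fun (h.const_mul (‖dmob lam w‖ ^ 2)) (fun z hz => ?_) measurableSet_ball
    simp only [hKe z hz, norm_mul, RCLike.norm_conj, smul_eq_mul]
    ring
  · rintro f ⟨hf, hfi⟩
    rw [intOn_dSigma] at hfi
    have hg : DifferentiableOn ℂ (fun z => f (mob lam z) * dmob lam z) (ball 0 1) :=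
      (DifferentiableOn.comp hf (mob_diff ha) hmaps).mul (dmob_diff ha)
    have hgi : IntegrableOn (fun z => ‖f (mob lam z) * dmob lam z‖ ^ 2 * ‖z‖ ^ θ) (ball 0 1) := by
      refine IntegrableOn.congr_fun ((cov_integrable ha _).mp hfi) (fun z hz => ?_) measurableSet_ball
      simp only [mob_mob ha (mem_ball_zero_iff.mp hz), norm_mul, smul_eq_mul]
      ring
    have h := disk0 _ hg (mob lam w) hmw θ hθ hgi
    rw [mob_mob ha hw] at h
    rw [int_dSigma, cov_integral ha]
    have e : ∀ z ∈ ball (0:ℂ) 1, (‖dmob lam z‖ ^ 2) • (f (mob lam z) *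
        (starRingEnd ℂ) (K (mob lam z) w) * ((‖mob lam (mob lam z)‖ ^ θ : ℝ) : ℂ)) =
        dmob lam w * (f (mob lam z) * dmob lam z * (starRingEnd ℂ) (K0 θ z (mob lam w)) *
          ((‖z‖ ^ θ : ℝ) : ℂ)) := by
      intro z hz
      have hz' := mem_ball_zero_iff.mp hz
      have hd := dmob_mob ha hz'
      have hd' : (starRingEnd ℂ) (dmob lam (mob lam z)) * (starRingEnd ℂ) (dmob lam z) = 1 := by
        rw [← map_mul, hd, map_one]
      have hn : ((‖dmob lam z‖ ^ 2 : ℝ) : ℂ) = dmob lam z * (starRingEnd ℂ) (dmob lam z) := by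
        rw [Complex.mul_conj, Complex.normSq_eq_norm_sq]
      rw [hKe _ (hmaps hz), mob_mob ha hz', Complex.real_smul, hn]
      simp only [map_mul, Complex.conj_conj]
      linear_combination (dmob lam z * f (mob lam z) * dmob lam w *
        (starRingEnd ℂ) (K0 θ z (mob lam w)) * ((‖z‖ ^ θ : ℝ) : ℂ)) * hd'
    rw [setIntegral_congr_fun measurableSet_ball e, integral_const_mul, h]
    have hd := dmob_mob ha hw
    have hpi : (Real.pi : ℂ) ≠ 0 := by exact_mod_cast Real.pi_ne_zero
    push_cast
    field_simp
    linear_combination f w * hd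

end
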